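/- arXiv:1602.05796 — 7 statements merged into one kernel-verified Lean document; each statement's English description precedes it below -/
import Mathlib

section
/- Let t ≥ 2 be an integer and let λ and μ be partitions of m with at most t² parts such that μ is obtained from λ by pushing down one box. Then Φ(μ) ≥ Φ(λ). -/
open Finset

/-- `μ` is obtained from `l` by pushing down one box: a box is moved from row `i`
to a lower row `j`, all other rows being unchanged. -/
def PushDown {s : ℕ} (l μ : Fin s → ℕ) : Prop :=
  ∃ i j : Fin s, i < j ∧ l i = μ i + 1 ∧ μ j = l j + 1 ∧
    ∀ k : Fin s, k ≠ i → k ≠ j → μ k = l k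

/-- `μ` is obtained from `l` by a finite nonempty sequence of single-box push-downs,
each intermediate step being again a partition (an antitone tuple). -/
def PushDownSeq {s : ℕ} (l μ : Fin s → ℕ) : Prop :=
  Relation.TransGen (fun a b => Antitone b ∧ PushDown a b) l μ

/-- The function `Φ(μ) = ∏ j, (μⱼ/m)^(-μⱼ/m)` (real powers, `0⁰ = 1`). -/
noncomputable def Phi {s : ℕ} (m : ℕ) (μ : Fin s → ℕ) : ℝ :=
  ∏ j : Fin s, ((μ j : ℝ) / m) ^ (-((μ j : ℝ) / m))

/-- The weight of a partition with at most `t²` parts: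
`wt μ = −(μ₁ + ⋯ + μ_{(t²−t)/2}) + (μ_{(t²−t)/2+1} + ⋯ + μ_{t²})`. -/
def wt (t : ℕ) (μ : Fin (t ^ 2) → ℕ) : ℤ :=
  ∑ j : Fin (t ^ 2), if (j : ℕ) < (t ^ 2 - t) / 2 then -(μ j : ℤ) else (μ j : ℤ)

/-- `μ` is the hook partition `h(s,r)`: the first `(t²−t)/2` parts equal `s`,
the remaining `(t²+t)/2` parts equal `r`, and `r < s`. -/
def IsHook (t : ℕ) (μ : Fin (t ^ 2) → ℕ) (s r : ℕ) : Prop :=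
  r < s ∧ ∀ j : Fin (t ^ 2), μ j = if (j : ℕ) < (t ^ 2 - t) / 2 then s else r

/-- A concave function has a larger sum at two points than at a pair of points with the same sum
that are further apart. -/
theorem ConcaveOn.add_le_add_of_mem_Icc {s : Set ℝ} {f : ℝ → ℝ} (hf : ConcaveOn ℝ s f)
    {x y u v : ℝ} (hx : x ∈ s) (hy : y ∈ s) (hxu : x ≤ u) (huy : u ≤ y) (h : u + v = x + y) :
    f x + f y ≤ f u + f v := by
  rcases (hxu.trans huy).eq_or_lt with rfl | hxy
  · obtain rfl : u = x := le_antisymm huy hxu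
    obtain rfl : v = u := by linarith
    exact le_rfl
  have hd : 0 < y - x := sub_pos.2 hxy
  have ha : 0 ≤ (y - u) / (y - x) := div_nonneg (sub_nonneg.2 huy) hd.le
  have hb : 0 ≤ (u - x) / (y - x) := div_nonneg (sub_nonneg.2 hxu) hd.le
  have hab : (y - u) / (y - x) + (u - x) / (y - x) = 1 := by
    field_simp
    ring
  have hu := hf.2 hx hy ha hb hab
  have hv := hf.2 hx hy hb ha (by rw [add_comm, hab])
  have hu' : (y - u) / (y - x) * x + (u - x) / (y - x) * y = u := by
    field_simp
    ring
  have hv' : (u - x) / (y - x) * x + (y - u) / (y - x) * y = v := by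
    rw [show v = x + y - u by linarith]
    field_simp
    ring
  simp only [smul_eq_mul, hu', hv'] at hu hv
  linear_combination hu + hv - (f x + f y) * hab

theorem Real.rpow_neg_self_eq_exp_negMulLog {x : ℝ} (hx : 0 ≤ x) :
    x ^ (-x) = Real.exp (Real.negMulLog x) := by
  rcases hx.eq_or_lt with rfl | hx
  · simp
  · rw [Real.rpow_def_of_pos hx, Real.negMulLog, mul_comm]

theorem Phi_eq_exp_sum_negMulLog {s : ℕ} (m : ℕ) (μ : Fin s → ℕ) :
    Phi m μ = Real.exp (∑ j, Real.negMulLog ((μ j : ℝ) / m)) := by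
  rw [Phi, Real.exp_sum]
  exact Finset.prod_congr rfl fun j _ => Real.rpow_neg_self_eq_exp_negMulLog (by positivity)

theorem PushDown.Phi_le {s : ℕ} (m : ℕ) {l μ : Fin s → ℕ} (h : PushDown l μ) (hμ : Antitone μ) :
    Phi m l ≤ Phi m μ := by
  obtain ⟨i, j, hij, hi, hj, hk⟩ := h
  rw [Phi_eq_exp_sum_negMulLog, Phi_eq_exp_sum_negMulLog, Real.exp_le_exp, ← sub_nonneg,
    ← Finset.sum_sub_distrib, Fintype.sum_eq_add i j hij.ne fun k hkij => by
      rw [hk k hkij.1 hkij.2, sub_self]]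
  have hji : l j ≤ μ i := by
    have := hμ hij.le
    omega
  have hil : μ i ≤ l i := by omega
  have hsum : μ i + μ j = l j + l i := by omega
  have key := Real.concaveOn_negMulLog.add_le_add_of_mem_Icc
    (x := (l j : ℝ) / m) (y := (l i : ℝ) / m) (u := (μ i : ℝ) / m) (v := (μ j : ℝ) / m)
    (Set.mem_Ici.2 (by positivity)) (Set.mem_Ici.2 (by positivity))
    (by gcongr) (by gcongr) (by
      rw [← add_div, ← add_div]
      exact_mod_cast congrArg (fun n : ℕ => (n : ℝ) / m) hsum)
  linarith

theorem pushdown_increases_Phi (t m : ℕ) (ht : 2 ≤ t)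
    (l μ : Fin (t ^ 2) → ℕ) (hl : Antitone l) (hμ : Antitone μ)
    (hlm : ∑ j, l j = m) (hμm : ∑ j, μ j = m)
    (h : PushDown l μ) :
    Phi m l ≤ Phi m μ :=
  h.Phi_le m hμ
end

section
/- Let t ≥ 2 be an integer, let m be a positive multiple of t(t²−1), and let ν be a partition of m with at most t² parts such that wt ν = 0. Then Φ(ν) ≤ t·√(t²−1). -/
open Finset

theorem negMulLog_le_mul_log_add {p c : ℝ} (hp : 0 ≤ p) (hc : 0 < c) :
    Real.negMulLog p ≤ p * Real.log c + (c⁻¹ - p) := by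
  rcases hp.eq_or_lt with rfl | hp
  · simpa using hc.le
  have h := mul_le_mul_of_nonneg_left
    (Real.log_le_sub_one_of_pos (inv_pos.2 (mul_pos hc hp))) hp.le
  rw [Real.log_inv, Real.log_mul hc.ne' hp.ne'] at h
  have e : p * ((c * p)⁻¹ - 1) = c⁻¹ - p := by field_simp
  rw [e] at h
  rw [Real.negMulLog]
  linarith

theorem sum_fin_ite_lt_const {n a : ℕ} (h : a ≤ n) (x y : ℝ) :
    ∑ j : Fin n, (if (j : ℕ) < a then x else y) = a * x + (n - a) * y := by
  obtain ⟨b, rfl⟩ := Nat.exists_eq_add_of_le h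
  simp [Fin.sum_univ_add]

theorem Phi_le_of_weight_zero (t i m : ℕ) (ht : 2 ≤ t) (hi : 0 < i)
    (hm : m = i * (t * (t ^ 2 - 1)))
    (ν : Fin (t ^ 2) → ℕ) (hν : Antitone ν) (hsum : ∑ j, ν j = m)
    (hwt : wt t ν = 0) :
    Phi m ν ≤ (t : ℝ) * Real.sqrt ((t : ℝ) ^ 2 - 1) := by
  have hm0 : (0 : ℝ) < m := by
    have : 0 < t ^ 2 - 1 := Nat.sub_pos_of_lt (by nlinarith)
    rw [hm]
    exact_mod_cast (by positivity : 0 < i * (t * (t ^ 2 - 1)))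
  have htR : (2 : ℝ) ≤ t := by exact_mod_cast ht
  have htt : t ≤ t ^ 2 := by nlinarith
  set a := (t ^ 2 - t) / 2 with ha
  have han : a ≤ t ^ 2 := by omega
  have h2a : (2 * a : ℝ) = t ^ 2 - t := by
    have hdvd : 2 ∣ t ^ 2 - t := by
      rw [pow_two, ← Nat.mul_sub_one]
      exact (Nat.even_mul_pred_self t).two_dvd
    have h : 2 * a + t = t ^ 2 := by omega
    rw [eq_sub_iff_add_eq]
    exact_mod_cast h
  have hA : (0 : ℝ) < t ^ 2 - t := by nlinarith
  have hB : (0 : ℝ) < t ^ 2 + t := by positivity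
  have hp : ∑ j, (ν j : ℝ) / m = 1 := by
    rw [← Finset.sum_div, ← Nat.cast_sum, hsum, div_self hm0.ne']
  have hw : ∑ j : Fin (t ^ 2), (if (j : ℕ) < a then -((ν j : ℝ) / m) else (ν j : ℝ) / m) = 0 := by
    have h : ((wt t ν : ℤ) : ℝ) / m = 0 := by simp [hwt]
    rw [wt, Int.cast_sum, Finset.sum_div] at h
    rw [← h]
    refine Finset.sum_congr rfl fun j _ => ?_
    split_ifs <;> simp [neg_div]
  set L := Real.log ((t : ℝ) ^ 2 - t) with hL
  set M := Real.log ((t : ℝ) ^ 2 + t) with hM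
  have key : ∑ j, Real.negMulLog ((ν j : ℝ) / m) ≤ (L + M) / 2 := by
    calc ∑ j, Real.negMulLog ((ν j : ℝ) / m)
        ≤ ∑ j : Fin (t ^ 2), ((ν j : ℝ) / m * ((L + M) / 2 - 1)
            + (if (j : ℕ) < a then -((ν j : ℝ) / m) else (ν j : ℝ) / m) * ((M - L) / 2)
            + (if (j : ℕ) < a then ((t : ℝ) ^ 2 - t)⁻¹ else ((t : ℝ) ^ 2 + t)⁻¹)) := by
          refine Finset.sum_le_sum fun j _ => ?_
          have h0 : (0 : ℝ) ≤ (ν j : ℝ) / m := by positivity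
          split_ifs
          · linarith [negMulLog_le_mul_log_add h0 hA]
          · linarith [negMulLog_le_mul_log_add h0 hB]
      _ = (L + M) / 2 := by
          rw [Finset.sum_add_distrib, Finset.sum_add_distrib, ← Finset.sum_mul, ← Finset.sum_mul,
            hp, hw, sum_fin_ite_lt_const han]
          have e1 : (a : ℝ) = (t ^ 2 - t) / 2 := by linarith
          have e2 : (((t ^ 2 : ℕ) : ℝ) - a) = (t ^ 2 + t) / 2 := by push_cast; linarith
          rw [e2, e1, div_mul_eq_mul_div, div_mul_eq_mul_div, mul_inv_cancel₀ hA.ne',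
            mul_inv_cancel₀ hB.ne']
          ring
  rw [Phi_eq_exp_sum_negMulLog]
  refine (Real.exp_le_exp.2 key).trans_eq ?_
  rw [hL, hM, ← Real.log_mul hA.ne' hB.ne', Real.exp_half, Real.exp_log (mul_pos hA hB),
    show ((t : ℝ) ^ 2 - t) * (t ^ 2 + t) = t ^ 2 * (t ^ 2 - 1) by ring,
    Real.sqrt_mul (sq_nonneg _), Real.sqrt_sq (by positivity)]
end

section
/- Let λ = (λ₁, …, λ_s) be a partition of n with s parts (λ₁ ≥ … ≥ λ_s ≥ 0) such that λ₁ − λ_s ≥ 2s. Then there is a partition μ = (μ₁, …, μ_s) of n obtained from λ by pushing down one or more boxes (i.e. by a finite sequence of single-box push-downs) such that μ_s = λ_s + 1 and μ₁ > λ₁ − s. -/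
open Finset

theorem PushDown.sum_eq {s : ℕ} {l μ : Fin s → ℕ} (h : PushDown l μ) :
    ∑ k, μ k = ∑ k, l k := by
  obtain ⟨i, j, hij, hi, hj, hk⟩ := h
  have hi' : i ∈ (univ : Finset (Fin s)) := mem_univ i
  have hj' : j ∈ (univ : Finset (Fin s)).erase i := by simp [hij.ne']
  have hrest : ∑ k ∈ (univ.erase i).erase j, μ k = ∑ k ∈ (univ.erase i).erase j, l k :=
    sum_congr rfl fun k hk' => hk k (by grind) (by grind)
  rw [← add_sum_erase _ μ hi', ← add_sum_erase _ μ hj', ← add_sum_erase _ l hi',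
    ← add_sum_erase _ l hj', hrest]
  omega

/-- Moving a box from the last row of a plateau to the first row of another plateau at least two
levels below it gives again a partition. -/
theorem exists_antitone_pushDown {s : ℕ} {l : Fin s → ℕ} (hl : Antitone l) {i j : Fin s}
    (hij : l j + 2 ≤ l i) (hi : ∀ t, i < t → l t < l i) (hj : ∀ t, t < j → l j < l t) :
    ∃ μ : Fin s → ℕ, Antitone μ ∧ PushDown l μ ∧ μ i + 1 = l i ∧ μ j = l j + 1 ∧
      ∀ k, k ≠ i → k ≠ j → μ k = l k := by
  have hlt : i < j := by
    by_contra! h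
    have := hl h
    omega
  have hμ : ∃ μ : Fin s → ℕ, μ i + 1 = l i ∧ μ j = l j + 1 ∧
      ∀ k, k ≠ i → k ≠ j → μ k = l k :=
    ⟨fun k => if k = i then l i - 1 else if k = j then l j + 1 else l k, by grind⟩
  obtain ⟨μ, h1, h2, h3⟩ := hμ
  refine ⟨μ, fun a b hab => ?_, ⟨i, j, hlt, h1.symm, h2, h3⟩, h1, h2, h3⟩
  have := hl hab
  rcases hab.eq_or_lt with rfl | hab
  · rfl
  · grind

/-- The last row of a plateau. -/
theorem exists_last_eq {s : ℕ} {l : Fin s → ℕ} (hl : Antitone l) (z : Fin s) :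
    ∃ i, z ≤ i ∧ l i = l z ∧ ∀ t, i < t → l t < l i := by
  obtain ⟨i, hi, hmax⟩ := (univ.filter fun t => l t = l z).exists_max_image id ⟨z, by simp⟩
  simp only [mem_filter, mem_univ, true_and, id] at hi hmax
  exact ⟨i, hmax z rfl, hi, fun t ht =>
    lt_of_le_of_ne (hl ht.le) fun h => (hmax t (h.trans hi)).not_gt ht⟩

/-- The first row of a plateau. -/
theorem exists_first_eq {s : ℕ} {l : Fin s → ℕ} (hl : Antitone l) (w : Fin s) :
    ∃ j, j ≤ w ∧ l j = l w ∧ ∀ t, t < j → l j < l t := by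
  obtain ⟨j, hj, hmin⟩ := (univ.filter fun t => l t = l w).exists_min_image id ⟨w, by simp⟩
  simp only [mem_filter, mem_univ, true_and, id] at hj hmin
  exact ⟨j, hmin w rfl, hj, fun t ht =>
    lt_of_le_of_ne (hl ht.le) fun h => (hmin t (h.symm.trans hj)).not_gt ht⟩

/-- If the rows from `j` to `w` form the bottom plateau, raising all of them by boxes from the top
plateau raises row `w` by one and costs the top row at most `w - j + 1` boxes. -/
theorem exists_pushDownSeq_raise {s : ℕ} {z w : Fin s} (hw : ∀ t, t ≤ w) (k : ℕ) :
    ∀ (l : Fin s → ℕ) (j : Fin s), Antitone l → (j : ℕ) + k = w → l j = l w →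
      (∀ t, t < j → l j < l t) → l w + k + 2 ≤ l z →
      ∃ μ : Fin s → ℕ, Antitone μ ∧ ∑ t, μ t = ∑ t, l t ∧ PushDownSeq l μ ∧
        μ w = l w + 1 ∧ l z ≤ μ z + (k + 1) := by
  induction k with
  | zero =>
    intro l j hl hjk hjw hj hgap
    obtain rfl : j = w := Fin.ext hjk
    obtain ⟨i, -, hiz, hi⟩ := exists_last_eq hl z
    obtain ⟨μ, hμ, hp, h1, h2, h3⟩ :=
      exists_antitone_pushDown (i := i) (j := j) hl (by omega) hi hj
    exact ⟨μ, hμ, hp.sum_eq, .single ⟨hμ, hp⟩, h2, by grind⟩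
  | succ k ih =>
    intro l j hl hjk hjw hj hgap
    obtain ⟨i, -, hiz, hi⟩ := exists_last_eq hl z
    obtain ⟨ν, hν, hp, h1, h2, h3⟩ :=
      exists_antitone_pushDown (i := i) (j := j) hl (by omega) hi hj
    have hj1 : (j : ℕ) + 1 < s := by omega
    have hconst : ∀ t, j < t → ν t = l w := by
      intro t ht
      have h4 := hl ht.le
      have h5 := hl (hw t)
      grind
    have hνw : ν w = l w := hconst w (Fin.lt_def.2 (by omega))
    have hνj : ν ⟨j + 1, hj1⟩ = l w := hconst _ (Fin.lt_def.2 (by simp))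
    have hνz : l z ≤ ν z + 1 := by grind
    obtain ⟨μ, hμ, hsum, hseq, hμw, hμz⟩ := ih ν ⟨j + 1, hj1⟩ hν (by simp; omega)
      (hνj.trans hνw.symm)
      (fun t ht => by
        have : ν j ≤ ν t := hν (Fin.le_def.2 (by simpa [Fin.lt_def, Nat.lt_succ_iff] using ht))
        omega)
      (by omega)
    exact ⟨μ, hμ, hsum.trans hp.sum_eq, .head ⟨hν, hp⟩ hseq, by omega, by omega⟩

theorem pushdown_raise_last_row (s n : ℕ) (hs : 0 < s) (l : Fin s → ℕ)
    (hl : Antitone l) (hsum : ∑ j, l j = n)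
    (hgap : l ⟨s - 1, Nat.sub_lt hs one_pos⟩ + 2 * s ≤ l ⟨0, hs⟩) :
    ∃ μ : Fin s → ℕ, Antitone μ ∧ (∑ j, μ j = n) ∧ PushDownSeq l μ ∧
      μ ⟨s - 1, Nat.sub_lt hs one_pos⟩ = l ⟨s - 1, Nat.sub_lt hs one_pos⟩ + 1 ∧
      l ⟨0, hs⟩ < μ ⟨0, hs⟩ + s := by
  set z : Fin s := ⟨0, hs⟩
  set w : Fin s := ⟨s - 1, Nat.sub_lt hs one_pos⟩
  obtain ⟨j, hjw, hj, hfirst⟩ := exists_first_eq hl w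
  have hjpos : (j : ℕ) ≠ 0 := fun h => by
    obtain rfl : j = z := Fin.ext h
    omega
  have hjw' : (j : ℕ) ≤ s - 1 := hjw
  obtain ⟨μ, hμ, hμsum, hseq, hμw, hμz⟩ := exists_pushDownSeq_raise (z := z) (w := w)
    (fun t => Fin.le_def.2 (Nat.le_sub_one_of_lt t.2)) (s - 1 - j) l j hl
    (by simp [w]; omega) hj hfirst (by omega)
  exact ⟨μ, hμ, hμsum.trans hsum, hseq, hμw, by omega⟩
end

section
/- Let t ≥ 2 be an integer and let μ = (μ₁, …, μ_{t²}) be a partition of m with at most t² parts whose weight cannot be increased by pushing down boxes, i.e. every partition μ' of m obtained from μ by a finite sequence of single-box push-downs satisfies wt μ' ≤ wt μ. Then μ₁ − μ_{t²} ≤ 4t². -/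
open Finset

/-- An antitone tuple whose first and last entries differ by at least two admits a push-down to
an antitone tuple with the same sum and a smaller sum of squares. -/
lemma exists_pushDown_of_first_last {n : ℕ} (l : Fin n → ℕ) (hl : Antitone l) (p q : Fin n)
    (hpq : l q + 2 ≤ l p) (hp : ∀ k, l k ≤ l p) (hq : ∀ k, l q ≤ l k) :
    ∃ ν : Fin n → ℕ, Antitone ν ∧ PushDown l ν ∧ ∑ k, ν k = ∑ k, l k ∧
      ∑ k, ν k ^ 2 < ∑ k, l k ^ 2 := by
  obtain ⟨i, hi, hi'⟩ : ∃ i, l i = l p ∧ ∀ k, i < k → l k < l p := by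
    obtain ⟨i, hi, hmax⟩ := (univ.filter fun k => l k = l p).exists_max_image id ⟨p, by simp⟩
    refine ⟨i, by simpa using hi, fun k hk => lt_of_le_of_ne (hp k) fun h => ?_⟩
    exact absurd (hmax k (by simpa using h)) (not_le.2 hk)
  obtain ⟨j, hj, hj'⟩ : ∃ j, l j = l q ∧ ∀ k, k < j → l q < l k := by
    obtain ⟨j, hj, hmin⟩ := (univ.filter fun k => l k = l q).exists_min_image id ⟨q, by simp⟩
    refine ⟨j, by simpa using hj, fun k hk => lt_of_le_of_ne (hq k) fun h => ?_⟩
    exact absurd (hmin k (by simpa using h.symm)) (not_le.2 hk)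
  have hij : i < j := by
    by_contra h
    have := hl (not_lt.1 h)
    omega
  have hne : j ≠ i := hij.ne'
  set ν : Fin n → ℕ := fun k => if k = i then l i - 1 else if k = j then l j + 1 else l k with hν
  have hνi : ν i = l i - 1 := by simp [hν]
  have hνj : ν j = l j + 1 := by simp [hν, hne]
  have hνk : ∀ k, k ≠ i → k ≠ j → ν k = l k := fun k h1 h2 => by simp [hν, h1, h2]
  have split (f : Fin n → ℕ) : ∑ k, f k = f i + (f j + ∑ k ∈ (univ.erase i).erase j, f k) := by
    rw [add_sum_erase _ f (by simp [hne] : j ∈ univ.erase i), add_sum_erase _ f (mem_univ i)]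
  have rest (g : ℕ → ℕ) : ∑ k ∈ (univ.erase i).erase j, g (ν k) =
      ∑ k ∈ (univ.erase i).erase j, g (l k) := by
    refine sum_congr rfl fun k hk => ?_
    simp only [mem_erase] at hk
    rw [hνk k hk.2.1 hk.1]
  refine ⟨ν, fun x y hxy => ?_, ⟨i, j, hij, by omega, hνj, hνk⟩, ?_, ?_⟩
  · rcases hxy.eq_or_lt with rfl | hlt
    · exact le_rfl
    have h1 := hl hxy
    have h2 := hp y
    have h3 := hq x
    have h4 : x = i → l y < l p := fun h => hi' y (h ▸ hlt)
    have h5 : y = j → l q < l x := fun h => hj' x (h ▸ hlt)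
    simp only [hν]
    grind
  · rw [split ν, split l, rest fun x => x]
    omega
  · rw [split fun k => ν k ^ 2, split fun k => l k ^ 2, rest fun x => x ^ 2, hνi, hνj]
    obtain ⟨d, hd⟩ := Nat.exists_eq_add_of_le (show l j + 2 ≤ l i by omega)
    have : l i - 1 = l j + 1 + d := by omega
    rw [this, hd]
    nlinarith

/-- Every antitone tuple is balanced or can be pushed down to a balanced antitone tuple. -/
lemma exists_balanced_pushDownSeq {n : ℕ} (p q : Fin n) (hp : ∀ k, p ≤ k) (hq : ∀ k, k ≤ q)
    (l : Fin n → ℕ) (hl : Antitone l) :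
    ∃ ν : Fin n → ℕ, (ν = l ∨ PushDownSeq l ν) ∧ Antitone ν ∧ ∑ k, ν k = ∑ k, l k ∧
      ν p ≤ ν q + 1 := by
  induction hN : ∑ k, l k ^ 2 using Nat.strong_induction_on generalizing l with
  | _ N ih =>
    by_cases h : l p ≤ l q + 1
    · exact ⟨l, .inl rfl, hl, rfl, h⟩
    obtain ⟨l', hl', hpd, hs, hlt⟩ := exists_pushDown_of_first_last l hl p q (by omega)
      (fun k => hl (hp k)) (fun k => hl (hq k))
    obtain ⟨ν, hν, hanti, hsum, hbal⟩ := ih _ (hN ▸ hlt) l' hl' rfl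
    refine ⟨ν, .inr ?_, hanti, hsum.trans hs, hbal⟩
    rcases hν with rfl | hν
    · exact .single ⟨hl', hpd⟩
    · exact .head ⟨hl', hpd⟩ hν

lemma wt_eq_sum_sub_two_mul (t : ℕ) (μ : Fin (t ^ 2) → ℕ) :
    wt t μ = ∑ j, (μ j : ℤ) -
      2 * ∑ j with (j : Fin (t ^ 2)).val < (t ^ 2 - t) / 2, (μ j : ℤ) := by
  rw [wt, sum_filter, mul_sum, ← sum_sub_distrib]
  refine sum_congr rfl fun j _ => ?_
  split_ifs <;> ring

theorem weight_maximal_first_sub_last_le (t m : ℕ) (ht : 2 ≤ t)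
    (μ : Fin (t ^ 2) → ℕ) (hμ : Antitone μ) (hsum : ∑ j, μ j = m)
    (hmax : ∀ μ' : Fin (t ^ 2) → ℕ, PushDownSeq μ μ' → wt t μ' ≤ wt t μ) :
    μ ⟨0, pow_pos (by omega) 2⟩ ≤
      μ ⟨t ^ 2 - 1, Nat.sub_lt (pow_pos (by omega) 2) one_pos⟩ + 4 * t ^ 2 := by
  set p : Fin (t ^ 2) := ⟨0, pow_pos (by omega) 2⟩ with hp
  set q : Fin (t ^ 2) := ⟨t ^ 2 - 1, Nat.sub_lt (pow_pos (by omega) 2) one_pos⟩ with hq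
  have hpk : ∀ k, p ≤ k := fun k => Nat.zero_le _
  have hkq : ∀ k, k ≤ q := fun k => Nat.le_sub_one_of_lt k.isLt
  obtain ⟨ν, hν, hanti, hs, hbal⟩ := exists_balanced_pushDownSeq p q hpk hkq μ hμ
  have hwt : wt t ν ≤ wt t μ := by
    rcases hν with rfl | hν
    · exact le_rfl
    · exact hmax ν hν
  have hlow : ∀ k, ν q ≤ ν k := fun k => hanti (hkq k)
  have hhigh : ∀ k, ν k ≤ ν q + 1 := fun k => (hanti (hpk k)).trans hbal
  have hsq : t + 2 ≤ t ^ 2 := by nlinarith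
  set A : Finset (Fin (t ^ 2)) := univ.filter fun j => j.val < (t ^ 2 - t) / 2 with hA
  have hpA : p ∈ A := by simp [hA, hp]; omega
  have hqA : q ∈ Aᶜ := by simp [hA, hq]; omega
  rw [wt_eq_sum_sub_two_mul, wt_eq_sum_sub_two_mul] at hwt
  have hsA : ∑ j ∈ A, μ j ≤ ∑ j ∈ A, ν j := by
    zify at hs ⊢
    linarith
  have hsB : ∑ j ∈ Aᶜ, ν j ≤ ∑ j ∈ Aᶜ, μ j := by
    have h1 := sum_add_sum_compl A ν
    have h2 := sum_add_sum_compl A μ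
    omega
  obtain ⟨x, hxA, hx⟩ := exists_le_of_sum_le ⟨p, hpA⟩ hsA
  obtain ⟨y, hyB, hy⟩ := exists_le_of_sum_le ⟨q, hqA⟩ hsB
  have hAB : ∀ a ∈ A, ∀ b ∈ Aᶜ, μ b ≤ μ a := fun a ha b hb => hμ <| by
    simp only [hA, mem_compl, mem_filter, mem_univ, true_and] at ha hb
    exact Fin.le_def.2 (by omega)
  have hcard (S : Finset (Fin (t ^ 2))) : (S.card : ℤ) ≤ t ^ 2 := by
    exact_mod_cast (card_le_univ S).trans_eq (Fintype.card_fin _)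
  have hfirst : (μ p : ℤ) - ν q ≤ t ^ 2 := calc
    (μ p : ℤ) - ν q ≤ ∑ j ∈ A, ((μ j : ℤ) - ν q) :=
      single_le_sum (f := fun j => (μ j : ℤ) - ν q) (fun j hj => by
        have h1 := hAB j hj y hyB
        have h2 := hlow y
        omega) hpA
    _ ≤ ∑ j ∈ A, ((ν j : ℤ) - ν q) := by
      rw [sum_sub_distrib, sum_sub_distrib]
      exact sub_le_sub_right (by exact_mod_cast hsA) _
    _ ≤ ∑ j ∈ A, (1 : ℤ) := sum_le_sum fun j _ => by
      have := hhigh j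
      omega
    _ ≤ t ^ 2 := by simpa using hcard A
  have hlast : (ν q : ℤ) + 1 - μ q ≤ t ^ 2 := calc
    (ν q : ℤ) + 1 - μ q ≤ ∑ j ∈ Aᶜ, ((ν q : ℤ) + 1 - μ j) :=
      single_le_sum (f := fun j => (ν q : ℤ) + 1 - μ j) (fun j hj => by
        have h1 := hAB x hxA j hj
        have h2 := hhigh x
        omega) hqA
    _ ≤ ∑ j ∈ Aᶜ, ((ν q : ℤ) + 1 - ν j) := by
      rw [sum_sub_distrib, sum_sub_distrib]
      exact sub_le_sub_left (by exact_mod_cast hsB) _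
    _ ≤ ∑ j ∈ Aᶜ, (1 : ℤ) := sum_le_sum fun j _ => by
      have := hlow j
      omega
    _ ≤ t ^ 2 := by simpa using hcard Aᶜ
  zify
  nlinarith
end

section
/- Let t ≥ 2 be an integer and let μ = (μ₁, …, μ_{t²}) be a partition of m with at most t² parts whose weight cannot be increased by pushing down boxes, i.e. every partition μ' of m obtained from μ by a finite sequence of single-box push-downs satisfies wt μ' ≤ wt μ. Then wt μ ≥ −2t⁴. -/
open Finset

/-- Pushing down one box changes the tuple by `-1` at the source and `+1` at the target. -/
lemma PushDown.exists_cast_eq {s : ℕ} {l μ : Fin s → ℕ} (h : PushDown l μ) :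
    ∃ i j : Fin s, i < j ∧ l i = μ i + 1 ∧ μ j = l j + 1 ∧ ∀ k,
      (μ k : ℤ) = l k + (if k = i then -1 else 0) + (if k = j then 1 else 0) := by
  obtain ⟨i, j, hij, hi, hj, hk⟩ := h
  refine ⟨i, j, hij, hi, hj, fun k => ?_⟩
  by_cases hki : k = i
  · subst hki
    simp [hij.ne, hi]
  · by_cases hkj : k = j
    · subst hkj
      simp [hki, hj]
    · simp [hki, hkj, hk k hki hkj]

/-- A push-down whose result is a partition decreases the sum of squares. -/
lemma PushDown.sum_sq_lt {s : ℕ} {l μ : Fin s → ℕ} (h : PushDown l μ) (hμ : Antitone μ) :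
    ∑ k, μ k ^ 2 < ∑ k, l k ^ 2 := by
  obtain ⟨i, j, hij, hi, hj, hk⟩ := h.exists_cast_eq
  have hle := hμ hij.le
  have key : (∑ k, (μ k : ℤ) ^ 2) = ∑ k, (l k : ℤ) ^ 2 + (1 - 2 * l i) + (1 + 2 * l j) := by
    have hterm : ∀ k, (μ k : ℤ) ^ 2 = (l k : ℤ) ^ 2 + (if k = i then 1 - 2 * (l i : ℤ) else 0)
        + (if k = j then 1 + 2 * (l j : ℤ) else 0) := by
      intro k
      rw [hk k]
      have := hij.ne
      split_ifs <;> subst_vars <;> first | contradiction | ring1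
    simp only [hterm, sum_add_distrib, sum_ite_eq', mem_univ, if_true]
  zify
  rw [key]
  omega

/-- A partition with two rows differing by at least two admits a push-down. -/
lemma exists_antitone_pushDown_s7 {s : ℕ} {l : Fin s → ℕ} (hl : Antitone l) {a b : Fin s}
    (hab : l b + 2 ≤ l a) : ∃ μ : Fin s → ℕ, Antitone μ ∧ PushDown l μ := by
  obtain ⟨i, hi, hi'⟩ := exists_max_image (univ.filter fun k => l k = l a) id ⟨a, by simp⟩
  obtain ⟨j, hj, hj'⟩ := exists_min_image (univ.filter fun k => l k = l b) id ⟨b, by simp⟩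
  simp only [mem_filter, mem_univ, true_and, id] at hi hi' hj hj'
  have hij : i < j := by
    by_contra! h
    have := hl h
    omega
  have hlt_i : ∀ k, i < k → l k < l i := fun k hk =>
    lt_of_le_of_ne (hl hk.le) fun h => absurd (hi' k (h.trans hi)) hk.not_ge
  have hlt_j : ∀ k, k < j → l j < l k := fun k hk =>
    lt_of_le_of_ne (hl hk.le) fun h => absurd (hj' k (h.symm.trans hj)) hk.not_ge
  refine ⟨fun k => if k = i then l i - 1 else if k = j then l j + 1 else l k, ?_, ?_⟩
  · intro x y hxy
    rcases hxy.eq_or_lt with rfl | hxy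
    · exact le_rfl
    have h1 := hl hxy.le
    have h2 := hlt_i y
    have h3 := hlt_j x
    dsimp only
    split_ifs <;> subst_vars <;> omega
  · refine ⟨i, j, hij, ?_, ?_, fun k hki hkj => ?_⟩
    · simp only [if_true]
      omega
    · simp [hij.ne']
    · simp [hki, hkj]

/-- Every partition can be pushed down to one whose rows differ by at most one. -/
lemma exists_balanced_reflTransGen {s : ℕ} (l : Fin s → ℕ) (hl : Antitone l) :
    ∃ μ : Fin s → ℕ, Antitone μ ∧ (∀ a b, μ a ≤ μ b + 1) ∧
      Relation.ReflTransGen (fun a b => Antitone b ∧ PushDown a b) l μ := by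
  induction hn : ∑ k, l k ^ 2 using Nat.strong_induction_on generalizing l with
  | _ n ih =>
    by_cases hbal : ∀ a b, l a ≤ l b + 1
    · exact ⟨l, hl, hbal, .refl⟩
    · push Not at hbal
      obtain ⟨a, b, hab⟩ := hbal
      obtain ⟨ν, hν, hpush⟩ := exists_antitone_pushDown_s7 hl (a := a) (b := b) hab
      obtain ⟨μ, hμ, hμbal, hchain⟩ := ih _ (hn ▸ hpush.sum_sq_lt hν) ν hν rfl
      exact ⟨μ, hμ, hμbal, .head ⟨hν, hpush⟩ hchain⟩

lemma sum_range_sign (n p : ℕ) :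
    ∑ k ∈ range n, (if k < p then (-1 : ℤ) else 1) = n - 2 * min n p := by
  induction n with
  | zero => simp
  | succ n ih =>
    rw [sum_range_succ, ih]
    split_ifs <;> omega

/-- The weight of a partition whose rows differ by at most one is at least `-t²`. -/
lemma neg_sq_le_wt_of_balanced {t : ℕ} (μ : Fin (t ^ 2) → ℕ) (hbal : ∀ a b, μ a ≤ μ b + 1) :
    -((t : ℤ) ^ 2) ≤ wt t μ := by
  obtain h0 | hne := isEmpty_or_nonempty (Fin (t ^ 2))
  · simp only [wt, univ_eq_empty, sum_empty]
    nlinarith [sq_nonneg (t : ℤ)]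
  obtain ⟨b, -, hb⟩ := exists_min_image univ μ univ_nonempty
  set p := (t ^ 2 - t) / 2 with hp
  have hterm : ∀ k : Fin (t ^ 2), (μ b : ℤ) * (if (k : ℕ) < p then -1 else 1) + -1 ≤
      if (k : ℕ) < p then -(μ k : ℤ) else (μ k : ℤ) := by
    intro k
    have h1 := hbal k b
    have h2 := hb k (mem_univ k)
    split_ifs <;> omega
  have hsum := sum_le_sum fun k (_ : k ∈ univ) => hterm k
  rw [sum_add_distrib, ← mul_sum,
    Fin.sum_univ_eq_sum_range (fun k => if k < p then (-1 : ℤ) else 1), sum_range_sign] at hsum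
  have hnonneg : (0 : ℤ) ≤ (t ^ 2 : ℕ) - 2 * min ((t ^ 2 : ℕ) : ℤ) p := by omega
  have hmul := mul_nonneg (Int.natCast_nonneg (μ b)) hnonneg
  simp only [sum_const, card_univ, Fintype.card_fin, nsmul_eq_mul] at hsum
  unfold wt
  push_cast at hsum hmul
  linarith

theorem weight_maximal_wt_ge (t m : ℕ) (ht : 2 ≤ t)
    (μ : Fin (t ^ 2) → ℕ) (hμ : Antitone μ) (hsum : ∑ j, μ j = m)
    (hmax : ∀ μ' : Fin (t ^ 2) → ℕ, PushDownSeq μ μ' → wt t μ' ≤ wt t μ) :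
    -(2 * (t : ℤ) ^ 4) ≤ wt t μ := by
  obtain ⟨ν, -, hbal, hchain⟩ := exists_balanced_reflTransGen μ hμ
  have hle : wt t ν ≤ wt t μ := by
    rcases Relation.reflTransGen_iff_eq_or_transGen.mp hchain with rfl | h
    · exact le_rfl
    · exact hmax ν h
  have hν := neg_sq_le_wt_of_balanced ν hbal
  nlinarith [sq_nonneg ((t : ℤ) ^ 2 - 1), sq_nonneg ((t : ℤ) ^ 2)]
end

section
/- Let t ≥ 2 be an integer and let μ = (μ₁, …, μ_{t²}) be a partition of m with at most t² parts such that wt μ ≤ 1. Then there exist an integer m₀ ≥ m and a partition ν of m₀ with at most t² parts such that: (1) m₀ − m ≤ 6t⁶; (2) wt ν = 0; (3) m₀ is a multiple of t(t²−1); (4) Φ(μ) ≤ (m + 6t⁶)^{6t⁶(t⁴+t²+2)/m} · Φ(ν). -/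
open Finset

theorem sum_negMulLog_le_log_card {n : ℕ} (hn : 0 < n) (p : Fin n → ℝ)
    (hp : ∀ j, 0 ≤ p j) (hsum : ∑ j, p j = 1) :
    ∑ j, Real.negMulLog (p j) ≤ Real.log n := by
  have hn' : (0 : ℝ) < n := by exact_mod_cast hn
  have h := Real.concaveOn_negMulLog.le_map_sum (t := Finset.univ)
    (w := fun _ : Fin n => (n : ℝ)⁻¹) (p := p) (fun _ _ => by positivity)
    (by simp [hn'.ne']) (fun j _ => hp j)
  simp only [smul_eq_mul, ← Finset.mul_sum, hsum, mul_one] at h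
  rw [Real.negMulLog, Real.log_inv, neg_mul_neg] at h
  exact le_of_mul_le_mul_left h (by positivity)

/-- The unnormalised entropy `m H(μ/m)` does not decrease when `μ` is mixed with the uniform
vector of the same sum and then enlarged coordinatewise. -/
theorem mul_entropy_le_of_mix_le {n : ℕ} (hn : 0 < n) {m m₀ l : ℝ} (hm : 0 < m)
    (hl0 : 0 ≤ l) (hl1 : l ≤ 1) (μ ν : Fin n → ℝ) (hμ : ∀ j, 0 ≤ μ j)
    (hμm : ∑ j, μ j = m) (hνm : ∑ j, ν j = m₀)
    (hle : ∀ j, (1 - l) * μ j + l * (m / n) ≤ ν j) :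
    m * ∑ j, Real.negMulLog (μ j / m) ≤ m₀ * ∑ j, Real.negMulLog (ν j / m₀) := by
  have hn' : (0 : ℝ) < n := by exact_mod_cast hn
  set d : Fin n → ℝ := fun j => ν j - ((1 - l) * μ j + l * (m / n)) with hd
  have hd0 : ∀ j, 0 ≤ d j := fun j => sub_nonneg.2 (hle j)
  have hdsum : ∑ j, d j = m₀ - m := by
    simp only [hd, Finset.sum_sub_distrib, Finset.sum_add_distrib, ← Finset.mul_sum, hμm, hνm,
      Finset.sum_const, Finset.card_univ, Fintype.card_fin, nsmul_eq_mul]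
    field_simp
    ring
  have hD : 0 ≤ m₀ - m := hdsum ▸ Finset.sum_nonneg fun j _ => hd0 j
  have hm₀ : 0 < m₀ := by linarith
  have hdD : ∀ j, d j ≤ m₀ - m := fun j =>
    hdsum ▸ Finset.single_le_sum (fun i _ => hd0 i) (Finset.mem_univ j)
  have hcoord : ∀ j, (1 - l) * m / m₀ * Real.negMulLog (μ j / m)
      + l * m / m₀ * Real.negMulLog ((n : ℝ)⁻¹) ≤ Real.negMulLog (ν j / m₀) := by
    intro j
    have h := Real.concaveOn_negMulLog.le_map_sum (t := Finset.univ)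
      (w := ![(1 - l) * m / m₀, l * m / m₀, (m₀ - m) / m₀])
      (p := ![μ j / m, (n : ℝ)⁻¹, d j / (m₀ - m)])
      (by
        have : 0 ≤ 1 - l := by linarith
        intro i _
        fin_cases i <;> simp <;> positivity)
      (by simp [Fin.sum_univ_three]; field_simp; ring)
      (by
        have := hμ j
        have := hd0 j
        intro i _
        fin_cases i <;> simp <;> positivity)
    simp only [Fin.sum_univ_three, smul_eq_mul, Matrix.cons_val] at h
    have harg : (1 - l) * m / m₀ * (μ j / m) + l * m / m₀ * (n : ℝ)⁻¹
        + (m₀ - m) / m₀ * (d j / (m₀ - m)) = ν j / m₀ := by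
      have : (m₀ - m) * (d j / (m₀ - m)) = d j := by
        rcases hD.eq_or_lt with h0 | h0
        · have := hdD j
          have := hd0 j
          rw [← h0, zero_mul]
          linarith
        · field_simp
      rw [div_mul_eq_mul_div (m₀ - m), this]
      simp only [hd]
      field_simp
      ring
    rw [harg] at h
    have hlast : 0 ≤ (m₀ - m) / m₀ * Real.negMulLog (d j / (m₀ - m)) :=
      mul_nonneg (by positivity) (Real.negMulLog_nonneg (div_nonneg (hd0 j) hD)
        (div_le_one_of_le₀ (hdD j) hD))
    linarith
  have hsum := Finset.sum_le_sum fun j (_ : j ∈ Finset.univ) => hcoord j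
  have hunif : ∑ _j : Fin n, Real.negMulLog ((n : ℝ)⁻¹) = Real.log n := by
    simp [Real.negMulLog, hn'.ne']
  rw [Finset.sum_add_distrib, ← Finset.mul_sum, ← Finset.mul_sum, hunif] at hsum
  have hmax := sum_negMulLog_le_log_card hn (fun j => μ j / m)
    (fun j => div_nonneg (hμ j) hm.le) (by rw [← Finset.sum_div, hμm, div_self hm.ne'])
  set H := ∑ j, Real.negMulLog (μ j / m)
  calc m * H = m₀ * ((1 - l) * m / m₀ * H + l * m / m₀ * H) := by field_simp; ring
    _ ≤ m₀ * ((1 - l) * m / m₀ * H + l * m / m₀ * Real.log n) := by gcongr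
    _ ≤ _ := by gcongr

/-- An antitone nonnegative real vector whose sums over the first `a` and over the remaining
coordinates are almost equal lies below an antitone integer vector for which both sums equal
the same multiple of `h`. -/
theorem exists_antitone_ge_with_equal_sums {n a t h k : ℕ} (ha : 0 < a) (han : a < n)
    (ht : 1 ≤ t) (h1 : a * (t + 1) = h) (h2 : (n - a) * (t - 1) = h) (hk : h + n + 1 ≤ 2 * k)
    (hpos : 0 < h) (y : Fin n → ℝ) (hy : Antitone y) (hy0 : ∀ j, 0 ≤ y j)
    (hAB : |(∑ j with j.val < a, y j) - ∑ j with ¬ j.val < a, y j| ≤ 1) :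
    ∃ (ν : Fin n → ℕ) (q : ℕ), Antitone ν ∧ (∀ j, y j ≤ ν j) ∧
      ∑ j with j.val < a, ν j = h * q ∧ ∑ j with ¬ j.val < a, ν j = h * q ∧
      (2 * h * q : ℝ) ≤ ∑ j, y j + (2 * h * k + 2 * h + 2 * n + 1) := by
  have hcardS : #{j : Fin n | j.val < a} = a := by
    rw [Fin.card_filter_val_lt, min_eq_right han.le]
  have hcardT : #{j : Fin n | ¬ j.val < a} = n - a := by
    have := Finset.card_filter_add_card_filter_not (s := (Finset.univ : Finset (Fin n)))
      (fun j => j.val < a)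
    rw [hcardS, Finset.card_univ, Fintype.card_fin] at this
    omega
  have hsplit := Finset.sum_filter_add_sum_filter_not Finset.univ
    (fun j : Fin n => j.val < a) y
  set c : Fin n → ℕ := fun j => ⌈y j⌉₊ with hc
  have hcanti : Antitone c := fun i j hij => Nat.ceil_mono (hy hij)
  have hlow : ∀ s : Finset (Fin n), ∑ j ∈ s, y j ≤ ((∑ j ∈ s, c j : ℕ) : ℝ) := fun s => by
    push_cast
    exact Finset.sum_le_sum fun j _ => Nat.le_ceil _
  have hup : ∀ s : Finset (Fin n), ((∑ j ∈ s, c j : ℕ) : ℝ) ≤ ∑ j ∈ s, y j + n := fun s => by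
    push_cast
    calc ∑ j ∈ s, (c j : ℝ) ≤ ∑ j ∈ s, (y j + 1) :=
          Finset.sum_le_sum fun j _ => (Nat.ceil_lt_add_one (hy0 j)).le
      _ = ∑ j ∈ s, y j + #s := by simp [Finset.sum_add_distrib]
      _ ≤ _ := by
        gcongr
        simpa using Finset.card_le_univ s
  have hAl := hlow {j | j.val < a}
  have hAu := hup {j | j.val < a}
  have hBl := hlow {j | ¬ j.val < a}
  have hBu := hup {j | ¬ j.val < a}
  set A := ∑ j with j.val < a, c j with hA
  set B := ∑ j with ¬ j.val < a, c j with hB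
  obtain ⟨hAB1, hAB2⟩ := abs_le.1 hAB
  have hABn : A ≤ B + n + 1 := by
    have : (A : ℝ) ≤ B + n + 1 := by linarith
    exact_mod_cast this
  set N := max A B with hN
  have hNu : (2 * N : ℝ) ≤ ∑ j, y j + 2 * n + 1 := by
    rcases max_choice A B with e | e <;> rw [hN, e] <;> linarith
  set q₀ := N / h + 1 with hq₀
  have hqN : N ≤ h * q₀ := (Nat.lt_mul_div_succ N hpos).le
  have hqN' : h * q₀ ≤ N + h := by
    rw [hq₀, mul_add, mul_one]
    gcongr
    exact Nat.mul_div_le N h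
  have hAN : A ≤ N := le_max_left _ _
  have hBN : B ≤ N := le_max_right _ _
  obtain ⟨α, hα⟩ := Nat.exists_eq_add_of_le (hAN.trans hqN)
  obtain ⟨β, hβ⟩ := Nat.exists_eq_add_of_le (hBN.trans hqN)
  have hβk : β ≤ 2 * k := by
    rcases max_choice A B with e | e <;> omega
  obtain ⟨P, hP⟩ : ∃ P, P = (t + 1) * k := ⟨_, rfl⟩
  obtain ⟨Q, hQ⟩ : ∃ Q, Q = (t - 1) * k := ⟨_, rfl⟩
  have hPQ : P = Q + 2 * k := by
    rw [hP, hQ, ← add_mul]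
    congr 1
    omega
  refine ⟨fun j => c j + (if j.val < a then P else Q) + (if j.val = 0 then α else 0)
    + (if j.val = a then β else 0), q₀ + k, ?_, ?_, ?_, ?_, ?_⟩
  · intro i j hij
    have hcij := hcanti hij
    have hij' : i.val ≤ j.val := hij
    dsimp only
    split_ifs <;> omega
  · intro j
    refine (Nat.le_ceil (y j)).trans ?_
    push_cast
    have : (0 : ℝ) ≤ (if j.val < a then (P : ℝ) else Q) := by positivity
    have : (0 : ℝ) ≤ (if j.val = 0 then (α : ℝ) else 0) := by positivity
    have : (0 : ℝ) ≤ (if j.val = a then (β : ℝ) else 0) := by positivity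
    linarith
  · have e1 : ∑ j : Fin n with j.val < a, (if j.val < a then P else Q) = a * P := by
      rw [Finset.sum_congr rfl (g := fun _ => P) fun j hj => if_pos (Finset.mem_filter.1 hj).2,
        Finset.sum_const, hcardS, smul_eq_mul]
    have e2 : ∑ j : Fin n with j.val < a, (if j.val = 0 then α else 0) = α := by
      rw [Finset.sum_eq_single_of_mem ⟨0, by omega⟩ (by simpa using ha)]
      · simp
      · intro j _ hj
        exact if_neg fun h0 => hj (Fin.ext h0)
    have e3 : ∑ j : Fin n with j.val < a, (if j.val = a then β else 0) = 0 :=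
      Finset.sum_eq_zero fun j hj => if_neg (Finset.mem_filter.1 hj).2.ne
    rw [Finset.sum_add_distrib, Finset.sum_add_distrib, Finset.sum_add_distrib, e1, e2, e3,
      mul_add, hα, hP, ← mul_assoc, h1]
    ring
  · have e1 : ∑ j : Fin n with ¬ j.val < a, (if j.val < a then P else Q) = (n - a) * Q := by
      rw [Finset.sum_congr rfl (g := fun _ => Q) fun j hj => if_neg (Finset.mem_filter.1 hj).2,
        Finset.sum_const, hcardT, smul_eq_mul]
    have e2 : ∑ j : Fin n with ¬ j.val < a, (if j.val = 0 then α else 0) = 0 :=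
      Finset.sum_eq_zero fun j hj => if_neg fun h0 =>
        (Finset.mem_filter.1 hj).2 (h0.trans_lt ha)
    have e3 : ∑ j : Fin n with ¬ j.val < a, (if j.val = a then β else 0) = β := by
      rw [Finset.sum_eq_single_of_mem ⟨a, han⟩ (by simp)]
      · simp
      · intro j _ hj
        exact if_neg fun h0 => hj (Fin.ext h0)
    rw [Finset.sum_add_distrib, Finset.sum_add_distrib, Finset.sum_add_distrib, e1, e2, e3,
      mul_add, hβ, hQ, ← mul_assoc, h2]
    ring
  · have : (h * q₀ : ℝ) ≤ N + h := by exact_mod_cast hqN'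
    push_cast
    linarith

/-- If `v ≤ 1` and `0 < w`, some convex combination of `v` and `w` lies in `[0, 1]`. -/
theorem exists_convex_combination_mem_unit {v w : ℝ} (hv : v ≤ 1) (hw : 0 < w) :
    ∃ l : ℝ, 0 ≤ l ∧ l ≤ 1 ∧ |(1 - l) * v + l * w| ≤ 1 := by
  rcases le_or_gt 0 v with h | h
  · exact ⟨0, le_rfl, zero_le_one, by simpa [abs_of_nonneg h] using hv⟩
  · have hvw : 0 < w - v := by linarith
    refine ⟨-v / (w - v), div_nonneg (by linarith) hvw.le,
      (div_le_one hvw).2 (by linarith), ?_⟩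
    have : (1 - -v / (w - v)) * v + -v / (w - v) * w = 0 := by
      field_simp
      ring
    rw [this, abs_zero]
    exact zero_le_one

theorem wt_eq_sum_sub_sum (t : ℕ) (μ : Fin (t ^ 2) → ℕ) :
    wt t μ = ((∑ j with ¬ j.val < (t ^ 2 - t) / 2, μ j : ℕ) : ℤ)
      - ((∑ j with j.val < (t ^ 2 - t) / 2, μ j : ℕ) : ℤ) := by
  rw [wt, Finset.sum_ite, Finset.sum_neg_distrib]
  push_cast
  ring

theorem reduce_to_weight_zero (t m : ℕ) (ht : 2 ≤ t) (hm : 0 < m)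
    (μ : Fin (t ^ 2) → ℕ) (hμ : Antitone μ) (hsum : ∑ j, μ j = m)
    (hwt : wt t μ ≤ 1) :
    ∃ m₀ : ℕ, m ≤ m₀ ∧ ∃ ν : Fin (t ^ 2) → ℕ,
      Antitone ν ∧ (∑ j, ν j = m₀) ∧
      m₀ - m ≤ 6 * t ^ 6 ∧
      wt t ν = 0 ∧
      (t * (t ^ 2 - 1)) ∣ m₀ ∧
      Phi m μ ≤ ((m : ℝ) + 6 * (t : ℝ) ^ 6) ^
          ((6 * (t : ℝ) ^ 6 * ((t : ℝ) ^ 4 + (t : ℝ) ^ 2 + 2)) / (m : ℝ)) *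
        Phi m₀ ν := by
  have ht2 : 2 * t ≤ t ^ 2 := by nlinarith
  have hn : 0 < t ^ 2 := by positivity
  have heven : 2 ∣ t ^ 2 - t := by
    rw [sq, ← Nat.mul_sub_one]
    exact (Nat.even_mul_pred_self t).two_dvd
  have hwt_eq := wt_eq_sum_sub_sum t
  obtain ⟨a, ha⟩ : ∃ a, a = (t ^ 2 - t) / 2 := ⟨_, rfl⟩
  rw [← ha] at hwt_eq
  have h2a : 2 * a + t = t ^ 2 := by omega
  have ha0 : 0 < a := by omega
  have han : a < t ^ 2 := by omega
  obtain ⟨h, hh⟩ : ∃ h, a * (t + 1) = h := ⟨_, rfl⟩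
  obtain ⟨u, htu⟩ : ∃ u, t = u + 1 := ⟨t - 1, by omega⟩
  have hh2 : (t ^ 2 - a) * (t - 1) = h := by
    have e : t ^ 2 - a = a + t := by omega
    have e' : t - 1 = u := by omega
    rw [e, e', ← hh]
    nlinarith
  have hM : t * (t ^ 2 - 1) = 2 * h := by
    have e : t ^ 2 - 1 = u * (t + 1) := by
      rw [Nat.sub_eq_iff_eq_add (by omega), htu]
      ring
    have e' : 2 * a = t * u := by nlinarith
    rw [e, ← hh, ← mul_assoc, ← mul_assoc, e']
  have hpos : 0 < h := hh ▸ by positivity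
  have hh3 : 2 * h ≤ t ^ 3 := by
    rw [← hM, pow_succ' t 2]
    exact Nat.mul_le_mul_left _ (Nat.sub_le _ _)
  have hmR : (0 : ℝ) < m := by exact_mod_cast hm
  have htR : (2 : ℝ) ≤ t := by exact_mod_cast ht
  obtain ⟨l, hl0, hl1, hl⟩ := exists_convex_combination_mem_unit
    (v := (wt t μ : ℝ)) (w := (m : ℝ) / t) (by exact_mod_cast hwt) (by positivity)
  have hsumR : ∑ j, (μ j : ℝ) = m := by exact_mod_cast hsum
  obtain ⟨y, hy⟩ : ∃ y : Fin (t ^ 2) → ℝ,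
    y = fun j => (1 - l) * μ j + l * ((m : ℝ) / (t ^ 2 : ℕ)) := ⟨_, rfl⟩
  have hl' : 0 ≤ 1 - l := by linarith
  have hyanti : Antitone y := fun i j hij => by
    have : (μ j : ℝ) ≤ μ i := by exact_mod_cast hμ hij
    simp only [hy]
    gcongr
  have hy0 : ∀ j, 0 ≤ y j := fun j => by
    simp only [hy]
    positivity
  have hysum : ∑ j, y j = m := by
    simp only [hy, Finset.sum_add_distrib, ← Finset.mul_sum, hsumR, Finset.sum_const,
      Finset.card_univ, Fintype.card_fin, nsmul_eq_mul]
    field_simp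
    ring
  have hcardS : #{j : Fin (t ^ 2) | j.val < a} = a := by
    rw [Fin.card_filter_val_lt, min_eq_right han.le]
  have hcardT : #{j : Fin (t ^ 2) | ¬ j.val < a} = a + t := by
    have := Finset.card_filter_add_card_filter_not
      (s := (Finset.univ : Finset (Fin (t ^ 2)))) (fun j => j.val < a)
    rw [hcardS, Finset.card_univ, Fintype.card_fin] at this
    omega
  have hAB : |(∑ j with j.val < a, y j) - ∑ j with ¬ j.val < a, y j| ≤ 1 := by
    rw [abs_sub_comm]
    convert hl using 2
    simp only [hy, Finset.sum_add_distrib, ← Finset.mul_sum, Finset.sum_const, hcardS, hcardT,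
      nsmul_eq_mul, hwt_eq]
    push_cast
    field_simp
    ring
  obtain ⟨ν, q, hνanti, hyν, hνS, hνT, hνle⟩ := exists_antitone_ge_with_equal_sums
    (k := h + t ^ 2 + 1) ha0 han (by omega) hh hh2 (by omega) hpos y hyanti hy0 hAB
  have hνsum : ∑ j, ν j = 2 * h * q := by
    rw [← Finset.sum_filter_add_sum_filter_not Finset.univ (fun j => j.val < a), hνS, hνT]
    ring
  have hmm₀ : m ≤ 2 * h * q := by
    have : (m : ℝ) ≤ ((∑ j, ν j : ℕ) : ℝ) := by
      rw [← hysum]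
      push_cast
      exact Finset.sum_le_sum fun j _ => hyν j
    rw [← hνsum]
    exact_mod_cast this
  have hgap : 2 * h * q ≤ m + 6 * t ^ 6 := by
    rw [hysum] at hνle
    have hle : 2 * h * q ≤ m + (2 * h * (h + t ^ 2 + 1) + 2 * h + 2 * t ^ 2 + 1) := by
      exact_mod_cast hνle
    have b1 : 2 * h * (h + t ^ 2 + 1) ≤ t ^ 3 * (t ^ 3 + t ^ 2 + 1) :=
      Nat.mul_le_mul hh3 (by omega)
    have p : ∀ i ≤ 6, t ^ i ≤ t ^ 6 := fun i hi => Nat.pow_le_pow_right (by omega) hi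
    have p0 := p 0 (by norm_num)
    have p2 := p 2 (by norm_num)
    have p3 := p 3 (by norm_num)
    have p5 : 2 * t ^ 5 ≤ t ^ 6 := by
      rw [pow_succ' t 5]
      exact Nat.mul_le_mul_right _ ht
    have p3' : 8 * t ^ 3 ≤ t ^ 6 := by
      have : 2 ^ 3 ≤ t ^ 3 := Nat.pow_le_pow_left ht 3
      calc 8 * t ^ 3 ≤ t ^ 3 * t ^ 3 := Nat.mul_le_mul_right _ this
        _ = t ^ 6 := by ring
    have e : t ^ 3 * (t ^ 3 + t ^ 2 + 1) = t ^ 6 + t ^ 5 + t ^ 3 := by ring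
    rw [pow_zero] at p0
    omega
  refine ⟨2 * h * q, hmm₀, ν, hνanti, hνsum, by omega, ?_, ⟨q, by rw [hM]⟩, ?_⟩
  · rw [hwt_eq, hνS, hνT, sub_self]
  have hνsumR : ∑ j, (ν j : ℝ) = ((2 * h * q : ℕ) : ℝ) := by exact_mod_cast hνsum
  have hent := mul_entropy_le_of_mix_le hn hmR hl0 hl1 (fun j => (μ j : ℝ)) (fun j => (ν j : ℝ))
    (fun j => by positivity) hsumR hνsumR (fun j => by simpa only [hy] using hyν j)
  rw [Phi_eq_exp_sum_negMulLog, Phi_eq_exp_sum_negMulLog]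
  generalize 2 * h * q = m₀ at *
  have hm₀R : (0 : ℝ) < m₀ := by exact_mod_cast hm.trans_le hmm₀
  have hmax := sum_negMulLog_le_log_card hn (fun j => (ν j : ℝ) / m₀)
    (fun j => by positivity) (by rw [← Finset.sum_div, hνsumR, div_self hm₀R.ne'])
  set H := ∑ j, Real.negMulLog ((μ j : ℝ) / m)
  set H' := ∑ j, Real.negMulLog ((ν j : ℝ) / m₀)
  have hgapR : (m₀ : ℝ) - m ≤ 6 * (t : ℝ) ^ 6 := by
    have : (m₀ : ℝ) ≤ m + 6 * (t : ℝ) ^ 6 := by exact_mod_cast hgap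
    linarith
  have hbase : (0 : ℝ) < (m : ℝ) + 6 * (t : ℝ) ^ 6 := by positivity
  have hlogle : Real.log ((t ^ 2 : ℕ) : ℝ) ≤ Real.log ((m : ℝ) + 6 * (t : ℝ) ^ 6) := by
    apply Real.log_le_log (by positivity)
    push_cast
    have : (t : ℝ) ^ 2 ≤ (t : ℝ) ^ 6 := pow_le_pow_right₀ (by linarith) (by norm_num)
    have : (0 : ℝ) ≤ (t : ℝ) ^ 6 := by positivity
    linarith
  have hlog0 : 0 ≤ Real.log ((t ^ 2 : ℕ) : ℝ) := Real.log_natCast_nonneg _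
  rw [Real.rpow_def_of_pos hbase, ← Real.exp_add, Real.exp_le_exp]
  set L := Real.log ((m : ℝ) + 6 * (t : ℝ) ^ 6)
  have hL0 : 0 ≤ L := hlog0.trans hlogle
  have hDm : (0 : ℝ) ≤ (m₀ : ℝ) - m := sub_nonneg.2 (by exact_mod_cast hmm₀)
  have key : m * H ≤ L * (6 * (t : ℝ) ^ 6 * ((t : ℝ) ^ 4 + (t : ℝ) ^ 2 + 2)) + m * H' :=
    calc m * H ≤ m₀ * H' := hent
      _ = (m₀ - m) * H' + m * H' := by ring
      _ ≤ (m₀ - m) * L + m * H' := by gcongr; exact hmax.trans hlogle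
      _ ≤ 6 * (t : ℝ) ^ 6 * L + m * H' := by gcongr
      _ = L * (6 * (t : ℝ) ^ 6 * 1) + m * H' := by ring
      _ ≤ _ := by
        gcongr
        have : (0 : ℝ) ≤ (t : ℝ) ^ 4 + (t : ℝ) ^ 2 := by positivity
        linarith
  refine le_of_mul_le_mul_left (key.trans_eq ?_) hmR
  field_simp
end

section
/- Let t ≥ 2 be an integer. Then there exist a constant C > 0 and a natural number k (depending only on t) such that for every positive integer m and every partition μ = (μ₁, …, μ_{t²}) of m with at most t² parts satisfying wt μ ≤ 1, one has Φ(μ) ≤ (C·m^k)^{1/m} · t·√(t²−1). -/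
open Finset

/-- Gibbs' inequality in exponential form: the entropy of `μ / m` is at most its cross entropy
with respect to the weights `exp (-c j)`. -/
lemma Phi_le_exp_sum {s m : ℕ} (hm : 0 < m) {μ : Fin s → ℕ} (hμ : ∑ j, μ j = m)
    (c : Fin s → ℝ) (hc : ∑ j, Real.exp (-c j) ≤ 1) :
    Phi m μ ≤ Real.exp (∑ j, (μ j : ℝ) / m * c j) := by
  have hm' : (0 : ℝ) < m := by exact_mod_cast hm
  have hsum : ∑ j, (μ j : ℝ) / m = 1 := by
    rw [← Finset.sum_div, ← Nat.cast_sum, hμ, div_self hm'.ne']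
  have hterm : ∀ j, ((μ j : ℝ) / m) ^ (-((μ j : ℝ) / m)) ≤
      Real.exp ((μ j : ℝ) / m * c j + Real.exp (-c j) - (μ j : ℝ) / m) := by
    intro j
    have hx : 0 ≤ (μ j : ℝ) / m := by positivity
    generalize (μ j : ℝ) / m = x at hx ⊢
    rcases hx.eq_or_lt with rfl | hx
    · simpa using (Real.exp_pos _).le
    · rw [Real.rpow_def_of_pos hx, Real.exp_le_exp]
      have h := Real.add_one_le_exp (-c j - Real.log x)
      rw [Real.exp_sub, Real.exp_log hx, le_div_iff₀ hx] at h
      linarith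
  calc Phi m μ ≤ ∏ j, Real.exp ((μ j : ℝ) / m * c j + Real.exp (-c j) - (μ j : ℝ) / m) :=
        Finset.prod_le_prod (fun j _ => by positivity) fun j _ => hterm j
    _ = Real.exp (∑ j, (μ j : ℝ) / m * c j + ∑ j, Real.exp (-c j) - 1) := by
        rw [← Real.exp_sum, Finset.sum_sub_distrib, Finset.sum_add_distrib, hsum]
    _ ≤ _ := Real.exp_le_exp.2 (by linarith)

theorem Phi_le_of_weight_le_one (t : ℕ) (ht : 2 ≤ t) :
    ∃ C : ℝ, 0 < C ∧ ∃ k : ℕ, ∀ m : ℕ, 0 < m →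
      ∀ μ : Fin (t ^ 2) → ℕ, Antitone μ → (∑ j, μ j = m) → wt t μ ≤ 1 →
        Phi m μ ≤ (C * (m : ℝ) ^ k) ^ ((1 : ℝ) / (m : ℝ)) *
          ((t : ℝ) * Real.sqrt ((t : ℝ) ^ 2 - 1)) := by
  have ht' : (2 : ℝ) ≤ t := by exact_mod_cast ht
  obtain ⟨a, ha⟩ : ∃ a, (t ^ 2 - t) / 2 = a := ⟨_, rfl⟩
  have hle : t ≤ t ^ 2 := Nat.le_self_pow two_ne_zero t
  have h2a : 2 * a = t ^ 2 - t := by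
    rw [← ha]
    refine Nat.mul_div_cancel' ?_
    rw [sq, ← Nat.mul_sub_one]
    exact (Nat.even_mul_pred_self t).two_dvd
  have hat : a ≤ t ^ 2 := by omega
  have haR : 2 * (a : ℝ) = t ^ 2 - t := by
    rw [← Nat.cast_pow, ← Nat.cast_sub hle, ← h2a]; push_cast; ring
  have hp : (0 : ℝ) < t ^ 2 - t := by nlinarith
  have hq : (0 : ℝ) < t ^ 2 + t := by nlinarith
  obtain ⟨p, hpdef⟩ : ∃ p, p = Real.log ((t : ℝ) ^ 2 - t) := ⟨_, rfl⟩
  obtain ⟨q, hqdef⟩ : ∃ q, q = Real.log ((t : ℝ) ^ 2 + t) := ⟨_, rfl⟩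
  have hexp_p : Real.exp p = (t : ℝ) ^ 2 - t := by rw [hpdef, Real.exp_log hp]
  have hexp_q : Real.exp q = (t : ℝ) ^ 2 + t := by rw [hqdef, Real.exp_log hq]
  have hpq : p ≤ q := by rw [hpdef, hqdef]; exact Real.log_le_log hp (by linarith)
  have hroot : (t : ℝ) * Real.sqrt ((t : ℝ) ^ 2 - 1) = Real.exp ((p + q) / 2) := by
    rw [← Real.sqrt_sq (Real.exp_pos _).le, ← Real.exp_nat_mul]
    rw [show ((2 : ℕ) : ℝ) * ((p + q) / 2) = p + q by push_cast; ring, Real.exp_add, hexp_p, hexp_q,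
      show ((t : ℝ) ^ 2 - t) * (t ^ 2 + t) = t ^ 2 * (t ^ 2 - 1) by ring,
      Real.sqrt_mul (sq_nonneg _), Real.sqrt_sq (by linarith)]
  refine ⟨Real.exp (q - p), Real.exp_pos _, 0, fun m hm μ _ hμ hwt => ?_⟩
  have hm' : (0 : ℝ) < m := by exact_mod_cast hm
  have hcard : ∑ j : Fin (t ^ 2), Real.exp (-(if (j : ℕ) < a then p else q)) = 1 := by
    rw [Fin.sum_univ_eq_sum_range (fun j => Real.exp (-(if j < a then p else q))) (t ^ 2),
      ← Finset.sum_range_add_sum_Ico _ hat,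
      Finset.sum_congr rfl (g := fun _ => Real.exp (-p))
        (fun j hj => by rw [if_pos (Finset.mem_range.1 hj)]),
      Finset.sum_congr rfl (s₁ := Finset.Ico a (t ^ 2)) (g := fun _ => Real.exp (-q))
        (fun j hj => by rw [if_neg (Finset.mem_Ico.1 hj).1.not_gt])]
    simp only [Finset.sum_const, Finset.card_range, Nat.card_Ico, nsmul_eq_mul, Real.exp_neg,
      hexp_p, hexp_q, Nat.cast_sub hat]
    push_cast
    rw [show (a : ℝ) = (t ^ 2 - t) / 2 by linarith]
    rw [show (t : ℝ) ^ 2 - (t ^ 2 - t) / 2 = (t ^ 2 + t) / 2 by ring, div_mul_eq_mul_div,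
      div_mul_eq_mul_div, mul_inv_cancel₀ hp.ne', mul_inv_cancel₀ hq.ne']
    norm_num
  have hcross : ∑ j : Fin (t ^ 2), (μ j : ℝ) / m * (if (j : ℕ) < a then p else q) =
      (p + q) / 2 + (wt t μ : ℝ) / m * ((q - p) / 2) := by
    have h1 : (m : ℝ) = ∑ j, (μ j : ℝ) := by rw [← hμ]; push_cast; rfl
    have h2 : (p + q) / 2 = (∑ j, (μ j : ℝ)) / m * ((p + q) / 2) := by
      rw [← h1, div_self hm'.ne', one_mul]
    rw [h2, wt, ha]
    push_cast
    simp only [Finset.sum_div, Finset.sum_mul]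
    rw [← Finset.sum_add_distrib]
    refine Finset.sum_congr rfl fun j _ => ?_
    split_ifs <;> ring
  refine (Phi_le_exp_sum hm hμ _ hcard.le).trans ?_
  rw [hcross, hroot, pow_zero, mul_one, ← Real.exp_mul, ← Real.exp_add, Real.exp_le_exp]
  have hw : (wt t μ : ℝ) ≤ 1 := by exact_mod_cast hwt
  have hbound : (wt t μ : ℝ) / m * ((q - p) / 2) ≤ 1 / m * ((q - p) / 2) := by
    have : 0 ≤ (q - p) / 2 := by linarith
    gcongr
  have hnonneg : 0 ≤ 1 / (m : ℝ) * (q - p) := mul_nonneg (by positivity) (by linarith)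
  linarith
end
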